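/- Let f : ℝ³ → ℝ be continuously differentiable with f_v(t,u,v) ≠ 0 for all (t,u,v) ∈ ℝ³, where f_t, f_u, f_v denote the partial derivatives of f in its first, second and third arguments. Let φ : ℝ³ → ℝ be continuous and define g : ℝ³ → ℝ by g(t,u,v) = [φ(t,u,f(t,u,v)) − f(t,u,v)·f_u(t,u,v) − f_t(t,u,v)] / f_v(t,u,v). If x, y : I → ℝ are differentiable on an open interval I and satisfy x'(t) = f(t,x(t),y(t)) and y'(t) = g(t,x(t),y(t)) for all t ∈ I, then x is twice differentiable on I and x''(t) = φ(t, x(t), x'(t)) for all t ∈ I. -/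

import Mathlib

/-- Proposition 1 (quantitative core): if `g` is chosen by the inverse-problem formula
`g = (φ(t,u,f) − f·f_u − f_t)/f_v`, then the `x`-component of any flow of the system
`ẋ = f(t,x,y)`, `ẏ = g(t,x,y)` satisfies the prescribed scalar equation
`ẍ = φ(t,x,ẋ)`. -/
theorem prescribed_folding
    (f g φ : ℝ → ℝ → ℝ → ℝ)
    (hf : ContDiff ℝ 1 (fun p : ℝ × ℝ × ℝ => f p.1 p.2.1 p.2.2))
    (hfv : ∀ t u v, deriv (fun r => f t u r) v ≠ 0)
    (hφ : Continuous (fun p : ℝ × ℝ × ℝ => φ p.1 p.2.1 p.2.2))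
    (hgdef : ∀ t u v, g t u v =
      (φ t u (f t u v) - f t u v * deriv (fun r => f t r v) u
        - deriv (fun r => f r u v) t) / deriv (fun r => f t u r) v)
    (a b : ℝ) (x y : ℝ → ℝ)
    (hx : ∀ t ∈ Set.Ioo a b, HasDerivAt x (f t (x t) (y t)) t)
    (hy : ∀ t ∈ Set.Ioo a b, HasDerivAt y (g t (x t) (y t)) t) :
    ∀ t ∈ Set.Ioo a b, HasDerivAt (deriv x) (φ t (x t) (deriv x t)) t := by
  intro t ht
  set F : ℝ × ℝ × ℝ → ℝ := fun p => f p.1 p.2.1 p.2.2 with hF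
  have hd : HasFDerivAt F (fderiv ℝ F (t, x t, y t)) (t, x t, y t) :=
    (hf.differentiable (by norm_num) _).hasFDerivAt
  set L := fderiv ℝ F (t, x t, y t) with hL
  have h1 : HasDerivAt (fun r => f r (x t) (y t)) (L (1, 0, 0)) t :=
    hd.comp_hasDerivAt (f := fun r : ℝ => (r, x t, y t)) t
      ((hasDerivAt_id t).prodMk ((hasDerivAt_const t (x t)).prodMk (hasDerivAt_const t (y t))))
  have h2 : HasDerivAt (fun r => f t r (y t)) (L (0, 1, 0)) (x t) :=
    hd.comp_hasDerivAt (f := fun r : ℝ => (t, r, y t)) (x t)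
      ((hasDerivAt_const (x t) t).prodMk
        ((hasDerivAt_id (x t)).prodMk (hasDerivAt_const (x t) (y t))))
  have h3 : HasDerivAt (fun r => f t (x t) r) (L (0, 0, 1)) (y t) :=
    hd.comp_hasDerivAt (f := fun r : ℝ => (t, x t, r)) (y t)
      ((hasDerivAt_const (y t) t).prodMk
        ((hasDerivAt_const (y t) (x t)).prodMk (hasDerivAt_id (y t))))
  have h4 : HasDerivAt (fun r => f r (x r) (y r))
      (L (1, f t (x t) (y t), g t (x t) (y t))) t :=
    hd.comp_hasDerivAt (f := fun r : ℝ => (r, x r, y r)) t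
      ((hasDerivAt_id t).prodMk ((hx t ht).prodMk (hy t ht)))
  have hlin : ∀ p q : ℝ, L (1, p, q) = L (1, 0, 0) + p * L (0, 1, 0) + q * L (0, 0, 1) := by
    intro p q
    have : ((1, p, q) : ℝ × ℝ × ℝ) = (1, 0, 0) + p • (0, 1, 0) + q • (0, 0, 1) := by simp
    rw [this, map_add, map_add, map_smul, map_smul, smul_eq_mul, smul_eq_mul]
  have hne := hfv t (x t) (y t)
  have hg := hgdef t (x t) (y t)
  rw [h3.deriv] at hne
  rw [h1.deriv, h2.deriv, h3.deriv, eq_div_iff hne] at hg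
  have hval : φ t (x t) (deriv x t) = L (1, f t (x t) (y t), g t (x t) (y t)) := by
    rw [(hx t ht).deriv, hlin, hg]
    ring
  rw [hval]
  refine h4.congr_of_eventuallyEq ?_
  filter_upwards [isOpen_Ioo.mem_nhds ht] with s hs
  exact (hx s hs).deriv
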